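/- Let d ≥ 1, 1 < α < 2, and j ∈ {1, …, d}. Then: (i) for every Schwartz function φ on ℝ^d, the limit u(φ) := lim_{ε → 0⁺} ∫_{|x| > ε} x_j |x|^{−d−α} φ(x) dx exists, and u defines a tempered distribution on ℝ^d; and (ii) there exists a nonzero real constant c(d,α) such that the Fourier transform of u is the locally integrable function ξ ↦ i · c(d,α) · ξ_j |ξ|^{α−2}, that is, û(φ) = ∫_{ℝ^d} i · c(d,α) · ξ_j |ξ|^{α−2} φ(ξ) dξ for every Schwartz function φ. -/

import Mathlib

open MeasureTheory Metric Filter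

lemma integrable_norm_rpow_mul_min (d : ℕ) (hd : 0 < d) (α : ℝ) (hα1 : 1 < α) (hα2 : α < 2) :
    Integrable (fun x : EuclideanSpace ℝ (Fin d) => ‖x‖ ^ (1 - d - α) * min 1 ‖x‖) := by
  have : Nonempty (Fin d) := ⟨⟨0, hd⟩⟩
  rw [integrable_fun_norm_addHaar volume (f := fun r : ℝ => r ^ (1 - d - α) * min 1 r)]
  have hpow : ∀ y : ℝ, 0 < y → y ^ (d - 1) * (y ^ (1 - (d : ℝ) - α)) = y ^ (-α) := by
    intro y hy
    rw [← Real.rpow_natCast, ← Real.rpow_add hy, Nat.cast_sub hd]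
    congr 1; push_cast; ring
  have h : IntegrableOn (fun y : ℝ => y ^ (-α) * min 1 y) (Set.Ioi 0) := by
    rw [← Set.Ioc_union_Ioi_eq_Ioi (zero_le_one (α := ℝ))]
    refine IntegrableOn.union ?_ ?_
    · have h1 : IntegrableOn (fun y : ℝ => y ^ (1 - α)) (Set.Ioc 0 1) :=
        (intervalIntegrable_iff_integrableOn_Ioc_of_le zero_le_one).1
          (intervalIntegral.intervalIntegrable_rpow' (by linarith))
      refine h1.congr_fun (fun y hy => ?_) measurableSet_Ioc
      simp only
      rw [min_eq_right hy.2, ← Real.rpow_add_one hy.1.ne']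
      congr 1; ring
    · refine (integrableOn_Ioi_rpow_of_lt (a := -α) (by linarith) one_pos).congr_fun
        (fun y hy => ?_) measurableSet_Ioi
      simp only
      rw [min_eq_left (le_of_lt hy), mul_one]
  refine h.congr_fun (fun y hy => ?_) measurableSet_Ioi
  simp only [finrank_euclideanSpace, Fintype.card_fin, smul_eq_mul]
  rw [← mul_assoc, hpow y hy]

/-- The kernel `x_j |x|^{-d-α}`. -/
noncomputable def oddKernel (d : ℕ) (α : ℝ) (j : Fin d) (x : EuclideanSpace ℝ (Fin d)) : ℝ :=
  x j / ‖x‖ ^ ((d : ℝ) + α)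

lemma measurable_oddKernel (d : ℕ) (α : ℝ) (j : Fin d) : Measurable (oddKernel d α j) := by
  unfold oddKernel
  fun_prop

lemma oddKernel_neg (d : ℕ) (α : ℝ) (j : Fin d) (x : EuclideanSpace ℝ (Fin d)) :
    oddKernel d α j (-x) = -oddKernel d α j x := by
  simp [oddKernel, neg_div]

lemma abs_oddKernel_le (d : ℕ) (α : ℝ) (j : Fin d) (x : EuclideanSpace ℝ (Fin d)) :
    |oddKernel d α j x| ≤ ‖x‖ ^ (1 - d - α) := by
  rcases eq_or_ne x 0 with rfl | hx
  · simpa [oddKernel] using Real.rpow_nonneg le_rfl _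
  have hx' : 0 < ‖x‖ := norm_pos_iff.2 hx
  rw [oddKernel, abs_div, abs_of_nonneg (Real.rpow_nonneg (norm_nonneg x) _),
    div_le_iff₀ (by positivity), ← Real.rpow_add hx']
  simpa using PiLp.norm_apply_le x j

lemma norm_oddKernel_mul_le (d : ℕ) (α : ℝ) (j : Fin d) {x : EuclideanSpace ℝ (Fin d)} {z : ℂ}
    {C : ℝ} (hz : ‖z‖ ≤ C * min 1 ‖x‖) :
    ‖(oddKernel d α j x : ℂ) * z‖ ≤ C * (‖x‖ ^ (1 - d - α) * min 1 ‖x‖) := by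
  rw [norm_mul, Complex.norm_real, Real.norm_eq_abs, mul_left_comm]
  exact mul_le_mul (abs_oddKernel_le d α j x) hz (norm_nonneg _) (by positivity)

lemma integrable_oddKernel_mul (d : ℕ) (hd : 0 < d) (α : ℝ) (hα1 : 1 < α) (hα2 : α < 2)
    (j : Fin d) {g : EuclideanSpace ℝ (Fin d) → ℂ} (hg : AEStronglyMeasurable g)
    {C : ℝ} (hgC : ∀ x, ‖g x‖ ≤ C * min 1 ‖x‖) :
    Integrable (fun x => (oddKernel d α j x : ℂ) * g x) :=
  ((integrable_norm_rpow_mul_min d hd α hα1 hα2).const_mul C).mono'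
    ((Complex.measurable_ofReal.comp (measurable_oddKernel d α j)).aestronglyMeasurable.mul hg)
    (.of_forall fun x => norm_oddKernel_mul_le d α j (hgC x))

lemma norm_integral_oddKernel_mul_le (d : ℕ) (hd : 0 < d) (α : ℝ) (hα1 : 1 < α) (hα2 : α < 2)
    (j : Fin d) {g : EuclideanSpace ℝ (Fin d) → ℂ}
    {C : ℝ} (hgC : ∀ x, ‖g x‖ ≤ C * min 1 ‖x‖) :
    ‖∫ x, (oddKernel d α j x : ℂ) * g x‖ ≤
      C * ∫ x : EuclideanSpace ℝ (Fin d), ‖x‖ ^ (1 - d - α) * min 1 ‖x‖ := by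
  rw [← integral_const_mul]
  exact norm_integral_le_of_norm_le ((integrable_norm_rpow_mul_min d hd α hα1 hα2).const_mul C)
    (.of_forall fun x => norm_oddKernel_mul_le d α j (hgC x))

lemma SchwartzMap.norm_sub_neg_le {E : Type*} [NormedAddCommGroup E] [NormedSpace ℝ E]
    (φ : SchwartzMap E ℂ) (x : E) :
    ‖φ x - φ (-x)‖ ≤
      2 * (SchwartzMap.seminorm ℂ 0 0 φ + SchwartzMap.seminorm ℂ 0 1 φ) * min 1 ‖x‖ := by
  have h0 : 0 ≤ SchwartzMap.seminorm ℂ 0 0 φ := apply_nonneg _ _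
  have h1 : 0 ≤ SchwartzMap.seminorm ℂ 0 1 φ := apply_nonneg _ _
  rcases le_total 1 ‖x‖ with hx | hx
  · rw [min_eq_left hx]
    have := norm_sub_le (φ x) (φ (-x))
    have := φ.norm_le_seminorm ℂ x
    have := φ.norm_le_seminorm ℂ (-x)
    linarith
  · rw [min_eq_right hx]
    have := Convex.norm_image_sub_le_of_norm_fderiv_le (𝕜 := ℝ) (f := φ) (s := Set.univ)
      (C := SchwartzMap.seminorm ℂ 0 1 φ) (x := -x) (y := x)
      (fun y _ => φ.differentiableAt)
      (fun y _ => by simpa using φ.norm_iteratedFDeriv_le_seminorm ℂ 1 y)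
      convex_univ trivial trivial
    have h2 : ‖x - -x‖ = 2 * ‖x‖ := by
      rw [sub_neg_eq_add, ← two_smul ℝ x, norm_smul]; simp
    rw [h2] at this
    nlinarith [norm_nonneg x]

/-- The tempered distribution given by the principal value of `x_j |x|^{-d-α}`, in its
absolutely convergent antisymmetrized form. -/
noncomputable def pvOddKernel (d : ℕ) (hd : 0 < d) (α : ℝ) (hα1 : 1 < α) (hα2 : α < 2)
    (j : Fin d) : SchwartzMap (EuclideanSpace ℝ (Fin d)) ℂ →L[ℂ] ℂ :=
  SchwartzMap.mkCLMtoNormedSpace (𝕜 := ℂ) (σ := RingHom.id ℂ)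
    (fun φ => 2⁻¹ * ∫ x, (oddKernel d α j x : ℂ) * (φ x - φ (-x)))
    (fun φ ψ => by
      rw [← mul_add, ← integral_add]
      · congr 2 with x
        simp only [add_apply]
        ring
      all_goals
        exact integrable_oddKernel_mul d hd α hα1 hα2 j
          (by fun_prop) (SchwartzMap.norm_sub_neg_le _))
    (fun a φ => by
      simp only [RingHom.id_apply, smul_eq_mul]
      rw [mul_left_comm, ← integral_const_mul a]
      congr 2 with x
      simp only [smul_apply, smul_eq_mul]
      ring)
    (by
      set M := ∫ x : EuclideanSpace ℝ (Fin d), ‖x‖ ^ (1 - d - α) * min 1 ‖x‖ with hM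
      have hM0 : 0 ≤ M := integral_nonneg fun x => by positivity
      refine ⟨{(0, 0), (0, 1)}, 2 * M, by positivity, fun φ => ?_⟩
      have h := norm_integral_oddKernel_mul_le d hd α hα1 hα2 j (SchwartzMap.norm_sub_neg_le φ)
      rw [← hM] at h
      have ha : SchwartzMap.seminorm ℂ 0 0 φ ≤
          (({(0, 0), (0, 1)} : Finset (ℕ × ℕ)).sup (schwartzSeminormFamily ℂ _ _)) φ :=
        Seminorm.le_def.1 (Finset.le_sup (f := schwartzSeminormFamily ℂ _ _)
          (b := ((0, 0) : ℕ × ℕ)) (by simp)) φ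
      have hb : SchwartzMap.seminorm ℂ 0 1 φ ≤
          (({(0, 0), (0, 1)} : Finset (ℕ × ℕ)).sup (schwartzSeminormFamily ℂ _ _)) φ :=
        Seminorm.le_def.1 (Finset.le_sup (f := schwartzSeminormFamily ℂ _ _)
          (b := ((0, 1) : ℕ × ℕ)) (by simp)) φ
      rw [norm_mul, norm_inv, Complex.norm_ofNat]
      nlinarith)

lemma pvOddKernel_apply (d : ℕ) (hd : 0 < d) (α : ℝ) (hα1 : 1 < α) (hα2 : α < 2)
    (j : Fin d) (φ : SchwartzMap (EuclideanSpace ℝ (Fin d)) ℂ) :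
    pvOddKernel d hd α hα1 hα2 j φ =
      2⁻¹ * ∫ x, (oddKernel d α j x : ℂ) * (φ x - φ (-x)) := rfl

lemma setIntegral_oddKernel_mul (d : ℕ) (hd : 0 < d) (α : ℝ) (hα1 : 1 < α) (hα2 : α < 2)
    (j : Fin d) (φ : SchwartzMap (EuclideanSpace ℝ (Fin d)) ℂ) {ε : ℝ} (hε : 0 < ε) :
    ∫ x in {x : EuclideanSpace ℝ (Fin d) | ε < ‖x‖}, (oddKernel d α j x : ℂ) * φ x =
      2⁻¹ * ∫ x in {x : EuclideanSpace ℝ (Fin d) | ε < ‖x‖},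
        (oddKernel d α j x : ℂ) * (φ x - φ (-x)) := by
  set S := {x : EuclideanSpace ℝ (Fin d) | ε < ‖x‖} with hS
  have hSm : MeasurableSet S := measurableSet_lt measurable_const measurable_norm
  have hint : ∀ ψ : EuclideanSpace ℝ (Fin d) → ℂ, Continuous ψ →
      (∀ x, ‖ψ x‖ ≤ SchwartzMap.seminorm ℂ 0 0 φ) →
      IntegrableOn (fun x => (oddKernel d α j x : ℂ) * ψ x) S := by
    intro ψ hψ hb
    refine ((integrable_norm_rpow_mul_min d hd α hα1 hα2).const_mul
      (SchwartzMap.seminorm ℂ 0 0 φ / min 1 ε)).integrableOn.mono'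
      ((Complex.measurable_ofReal.comp
        (measurable_oddKernel d α j)).aestronglyMeasurable.mul hψ.aestronglyMeasurable)
      ((ae_restrict_iff' hSm).2 (.of_forall fun x hx => norm_oddKernel_mul_le d α j ?_))
    have hm : min 1 ε ≤ min 1 ‖x‖ := min_le_min le_rfl (le_of_lt hx)
    have hm0 : 0 < min 1 ε := lt_min one_pos hε
    have h0 : 0 ≤ SchwartzMap.seminorm ℂ 0 0 φ := apply_nonneg _ _
    rw [div_mul_eq_mul_div, le_div_iff₀ hm0]
    exact mul_le_mul (hb x) hm hm0.le h0
  have h1 := hint φ φ.continuous (φ.norm_le_seminorm ℂ)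
  have h2 := hint (fun x => φ (-x)) (by fun_prop) (fun x => φ.norm_le_seminorm ℂ (-x))
  have hneg : ∫ x in S, (oddKernel d α j x : ℂ) * φ (-x) =
      -∫ x in S, (oddKernel d α j x : ℂ) * φ x := by
    rw [← integral_neg, ← integral_indicator hSm, ← integral_indicator hSm,
      ← integral_neg_eq_self]
    congr 1 with x
    by_cases hx : x ∈ S
    · have hx' : -x ∈ S := by simpa [hS] using hx
      simp [hx, hx', oddKernel_neg]
    · have hx' : -x ∉ S := by simpa [hS] using hx
      simp [hx, hx']
  simp only [mul_sub]
  rw [integral_sub h1 h2, hneg]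
  ring

lemma tendsto_setIntegral_oddKernel_mul (d : ℕ) (hd : 0 < d) (α : ℝ) (hα1 : 1 < α) (hα2 : α < 2)
    (j : Fin d) (φ : SchwartzMap (EuclideanSpace ℝ (Fin d)) ℂ) :
    Tendsto (fun ε : ℝ => ∫ x in {x : EuclideanSpace ℝ (Fin d) | ε < ‖x‖},
        (oddKernel d α j x : ℂ) * φ x)
      (nhdsWithin 0 (Set.Ioi 0)) (nhds (pvOddKernel d hd α hα1 hα2 j φ)) := by
  rw [pvOddKernel_apply]
  have key : Tendsto (fun ε : ℝ => 2⁻¹ * ∫ x in {x : EuclideanSpace ℝ (Fin d) | ε < ‖x‖},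
      (oddKernel d α j x : ℂ) * (φ x - φ (-x))) (nhdsWithin 0 (Set.Ioi 0))
      (nhds (2⁻¹ * ∫ x, (oddKernel d α j x : ℂ) * (φ x - φ (-x)))) := by
    refine Tendsto.const_mul _ ?_
    have hint := integrable_oddKernel_mul d hd α hα1 hα2 j (g := fun x => φ x - φ (-x))
      (by fun_prop) (SchwartzMap.norm_sub_neg_le φ)
    have hSm : ∀ ε : ℝ, MeasurableSet {x : EuclideanSpace ℝ (Fin d) | ε < ‖x‖} :=
      fun ε => measurableSet_lt measurable_const measurable_norm
    simp_rw [← fun ε => integral_indicator (μ := volume)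
      (f := fun x => (oddKernel d α j x : ℂ) * (φ x - φ (-x))) (hSm ε)]
    refine tendsto_integral_filter_of_dominated_convergence _
      (.of_forall fun ε => hint.aestronglyMeasurable.indicator (hSm ε))
      (.of_forall fun ε => .of_forall fun x => norm_indicator_le_norm_self _ x)
      hint.norm (.of_forall fun x => ?_)
    refine tendsto_const_nhds.congr' ?_
    rcases eq_or_ne x 0 with rfl | hx
    · exact .of_forall fun ε => by simp [Set.indicator]
    · have : ∀ᶠ ε in nhdsWithin (0 : ℝ) (Set.Ioi 0), ε < ‖x‖ :=
        nhdsWithin_le_nhds (eventually_lt_nhds (norm_pos_iff.2 hx))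
      filter_upwards [this] with ε hε
      simp [hε]
  refine key.congr' ?_
  filter_upwards [self_mem_nhdsWithin] with ε hε
  exact (setIntegral_oddKernel_mul d hd α hα1 hα2 j φ hε).symm

lemma integrable_exp_neg_mul_norm_sq (d : ℕ) {b : ℝ} (hb : 0 < b) :
    Integrable (fun x : EuclideanSpace ℝ (Fin d) => Real.exp (-b * ‖x‖ ^ 2)) := by
  have := (GaussianFourier.integrable_cexp_neg_mul_sq_norm_add
    (V := EuclideanSpace ℝ (Fin d)) (b := b) (by simpa using hb) 0 0).re
  refine this.congr (.of_forall fun x => ?_)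
  simp only [inner_zero_left, Complex.ofReal_zero, mul_zero, add_zero, RCLike.re_to_complex]
  rw [← Complex.exp_ofReal_re]
  push_cast; rfl

lemma integrable_norm_mul_exp_neg_mul_norm_sq (d : ℕ) {b : ℝ} (hb : 0 < b) :
    Integrable (fun x : EuclideanSpace ℝ (Fin d) => ‖x‖ * Real.exp (-b * ‖x‖ ^ 2)) := by
  refine ((integrable_exp_neg_mul_norm_sq d (half_pos hb)).const_mul (1 + 2 / b)).mono'
    (by fun_prop) (.of_forall fun x => ?_)
  have h1 : ‖x‖ ≤ (1 + 2 / b) * Real.exp (b / 2 * ‖x‖ ^ 2) := by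
    have h2 := Real.add_one_le_exp (b / 2 * ‖x‖ ^ 2)
    have h3 : ‖x‖ ≤ (1 + 2 / b) * (b / 2 * ‖x‖ ^ 2 + 1) := by
      have : (1 + 2 / b) * (b / 2 * ‖x‖ ^ 2 + 1) =
          ‖x‖ ^ 2 + 1 + (b / 2 * ‖x‖ ^ 2 + 2 / b) := by field_simp; ring
      have h4 : 0 ≤ b / 2 * ‖x‖ ^ 2 + 2 / b := by positivity
      nlinarith [sq_nonneg (‖x‖ - 1)]
    exact h3.trans (by gcongr)
  rw [Real.norm_of_nonneg (by positivity)]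
  calc ‖x‖ * Real.exp (-b * ‖x‖ ^ 2)
      ≤ (1 + 2 / b) * Real.exp (b / 2 * ‖x‖ ^ 2) * Real.exp (-b * ‖x‖ ^ 2) := by gcongr
    _ = (1 + 2 / b) * Real.exp (-(b / 2) * ‖x‖ ^ 2) := by
      rw [mul_assoc, ← Real.exp_add]; ring_nf

lemma integral_exp_mul_cos_inner (d : ℕ) {t : ℝ} (ht : 0 < t) (ξ : EuclideanSpace ℝ (Fin d)) :
    ∫ x : EuclideanSpace ℝ (Fin d),
        Real.exp (-(Real.pi * t) * ‖x‖ ^ 2) * Real.cos (2 * Real.pi * inner ℝ ξ x) =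
      t ^ (-(d : ℝ) / 2) * Real.exp (-(Real.pi * ‖ξ‖ ^ 2 / t)) := by
  have hb : 0 < ((Real.pi * t : ℝ) : ℂ).re := by simpa using mul_pos Real.pi_pos ht
  have hi := GaussianFourier.integrable_cexp_neg_mul_sq_norm_add hb
    (2 * Real.pi * Complex.I) ξ
  have h := congrArg Complex.re (GaussianFourier.integral_cexp_neg_mul_sq_norm_add hb
    (2 * Real.pi * Complex.I) ξ)
  have hre := integral_re hi
  simp only [RCLike.re_to_complex] at hre
  rw [← hre] at h
  convert h using 1
  · congr 1 with x
    rw [Complex.exp_re]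
    congr 2
    · simp [← Complex.ofReal_pow]
    · simp [← Complex.ofReal_pow]
  · have hπ := Real.pi_pos
    have e1 : (Real.pi : ℂ) / ((Real.pi * t : ℝ) : ℂ) = ((t⁻¹ : ℝ) : ℂ) := by
      rw [← Complex.ofReal_div]; congr 1; field_simp
    have e2 : ((Module.finrank ℝ (EuclideanSpace ℝ (Fin d)) : ℂ) / 2) = (((d : ℝ) / 2 : ℝ) : ℂ) := by
      simp
    have e3 : (2 * (Real.pi : ℂ) * Complex.I) ^ 2 * (‖ξ‖ : ℂ) ^ 2 / (4 * ((Real.pi * t : ℝ) : ℂ)) =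
        ((-(Real.pi * ‖ξ‖ ^ 2 / t) : ℝ) : ℂ) := by
      have : (t : ℂ) ≠ 0 := by exact_mod_cast ht.ne'
      have : (Real.pi : ℂ) ≠ 0 := by exact_mod_cast hπ.ne'
      push_cast
      field_simp
      rw [Complex.I_sq]
      ring
    rw [e1, e2, e3, ← Complex.ofReal_cpow (by positivity), ← Complex.ofReal_exp,
      ← Complex.ofReal_mul, Complex.ofReal_re, Real.inv_rpow ht.le, ← Real.rpow_neg ht.le, neg_div]

lemma integral_coord_mul_exp_mul_sin_inner (d : ℕ) {t : ℝ} (ht : 0 < t) (j : Fin d)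
    (ξ : EuclideanSpace ℝ (Fin d)) :
    ∫ x : EuclideanSpace ℝ (Fin d),
        x j * Real.exp (-(Real.pi * t) * ‖x‖ ^ 2) * Real.sin (2 * Real.pi * inner ℝ ξ x) =
      ξ j * (t ^ (-(d : ℝ) / 2 - 1) * Real.exp (-(Real.pi * ‖ξ‖ ^ 2 / t))) := by
  have hπ := Real.pi_pos
  have hb : 0 < Real.pi * t := by positivity
  set v : EuclideanSpace ℝ (Fin d) := EuclideanSpace.single j 1 with hv
  set f : EuclideanSpace ℝ (Fin d) → ℝ := fun x => Real.exp (-(Real.pi * t) * ‖x‖ ^ 2) with hf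
  set g : EuclideanSpace ℝ (Fin d) → ℝ := fun x => Real.sin (2 * Real.pi * inner ℝ ξ x) with hg
  have hdf : ∀ x, HasFDerivAt f
      (Real.exp (-(Real.pi * t) * ‖x‖ ^ 2) • (-(Real.pi * t)) • (2 • innerSL ℝ x)) x := fun x =>
    (((hasStrictFDerivAt_norm_sq x).hasFDerivAt.const_mul _).exp)
  have hdg : ∀ x, HasFDerivAt g
      (Real.cos (2 * Real.pi * inner ℝ ξ x) • (2 * Real.pi) • innerSL ℝ ξ) x := fun x =>
    (((innerSL ℝ ξ).hasFDerivAt.const_mul (2 * Real.pi)).sin)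
  have hfv : ∀ x, fderiv ℝ f x v = -(2 * Real.pi * t) * (x j * f x) := fun x => by
    rw [(hdf x).fderiv]
    simp [hv, hf, EuclideanSpace.inner_single_right]
    ring
  have hgv : ∀ x, fderiv ℝ g x v =
      2 * Real.pi * ξ j * Real.cos (2 * Real.pi * inner ℝ ξ x) := fun x => by
    rw [(hdg x).fderiv]
    simp [hv, EuclideanSpace.inner_single_right]
    ring
  have hcoord : Integrable (fun x : EuclideanSpace ℝ (Fin d) => x j * f x) := by
    refine (integrable_norm_mul_exp_neg_mul_norm_sq d hb).mono' (by fun_prop)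
      (.of_forall fun x => ?_)
    rw [norm_mul, Real.norm_of_nonneg (Real.exp_pos _).le]
    gcongr
    exact PiLp.norm_apply_le x j
  have hif : Integrable f := integrable_exp_neg_mul_norm_sq d hb
  have key := integral_mul_fderiv_eq_neg_fderiv_mul_of_integrable (μ := volume)
    (f := f) (g := g) (v := v)
    (by
      simp_rw [hfv]
      exact (hcoord.const_mul _).mul_bdd (c := 1) (by fun_prop)
        (.of_forall fun x => Real.abs_sin_le_one _))
    (by
      simp_rw [hgv]
      refine hif.mul_bdd (c := |2 * Real.pi * ξ j|) (by fun_prop) (.of_forall fun x => ?_)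
      rw [norm_mul]
      exact mul_le_of_le_one_right (abs_nonneg _) (Real.abs_cos_le_one _))
    (hif.mul_bdd (c := 1) (by fun_prop) (.of_forall fun x => Real.abs_sin_le_one _))
    (fun x _ => (hdf x).differentiableAt) (fun x _ => (hdg x).differentiableAt)
  simp_rw [hfv, hgv] at key
  have e1 : ∫ x, f x * (2 * Real.pi * ξ j * Real.cos (2 * Real.pi * inner ℝ ξ x)) =
      2 * Real.pi * ξ j * (t ^ (-(d : ℝ) / 2) * Real.exp (-(Real.pi * ‖ξ‖ ^ 2 / t))) := by
    rw [← integral_exp_mul_cos_inner d ht ξ, ← integral_const_mul]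
    congr 1 with x
    simp only [hf]; ring
  have e2 : ∫ x, -(2 * Real.pi * t) * (x j * f x) * g x =
      -(2 * Real.pi * t) * ∫ x, x j * f x * g x := by
    rw [← integral_const_mul]
    congr 1 with x
    ring
  rw [e1, e2] at key
  rw [Real.rpow_sub_one ht.ne']
  have : ∫ x, x j * f x * g x = ξ j * (t ^ (-(d : ℝ) / 2) *
      Real.exp (-(Real.pi * ‖ξ‖ ^ 2 / t))) / t := by
    rw [eq_div_iff ht.ne']
    have h2π : 2 * Real.pi ≠ 0 := by positivity
    apply mul_left_cancel₀ h2π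
    linear_combination -key
  rw [this]
  ring

lemma integral_rpow_mul_exp_neg_div {a r : ℝ} (ha : 0 < a) (hr : 0 < r) :
    ∫ t in Set.Ioi (0 : ℝ), t ^ (-a - 1) * Real.exp (-(r / t)) = (1 / r) ^ a * Real.Gamma a := by
  rw [← Real.integral_rpow_mul_exp_neg_mul_Ioi ha hr,
    ← integral_comp_rpow_Ioi _ (p := -1) (by norm_num)]
  refine setIntegral_congr_fun measurableSet_Ioi fun t (ht : 0 < t) => ?_
  simp only [abs_neg, abs_one, one_mul, smul_eq_mul]
  rw [← mul_assoc, ← Real.rpow_mul ht.le, ← Real.rpow_add ht, Real.rpow_neg_one, div_eq_mul_inv]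
  congr 2
  · ring
  · rw [inv_inv]

lemma abs_sin_inner_le {E : Type*} [NormedAddCommGroup E] [InnerProductSpace ℝ E] (ξ x : E) :
    |Real.sin (2 * Real.pi * inner ℝ ξ x)| ≤ (1 + 2 * Real.pi * ‖ξ‖) * min 1 ‖x‖ := by
  have hπ := Real.pi_pos
  have h0 : 0 ≤ 2 * Real.pi * ‖ξ‖ := by positivity
  rcases le_total 1 ‖x‖ with hx | hx
  · rw [min_eq_left hx]
    linarith [Real.abs_sin_le_one (2 * Real.pi * inner ℝ ξ x)]
  · rw [min_eq_right hx]
    calc |Real.sin (2 * Real.pi * inner ℝ ξ x)| ≤ |2 * Real.pi * inner ℝ ξ x| := Real.abs_sin_le_abs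
      _ = 2 * Real.pi * |inner ℝ ξ x| := by rw [abs_mul, abs_of_pos (by positivity)]
      _ ≤ 2 * Real.pi * (‖ξ‖ * ‖x‖) := by gcongr; exact abs_real_inner_le_norm ξ x
      _ ≤ (1 + 2 * Real.pi * ‖ξ‖) * ‖x‖ := by linarith [norm_nonneg x]

lemma integrableOn_rpow_mul_exp_neg_mul {a r : ℝ} (ha : 0 < a) (hr : 0 < r) :
    IntegrableOn (fun t : ℝ => t ^ (a - 1) * Real.exp (-(r * t))) (Set.Ioi 0) := by
  refine (integrableOn_rpow_mul_exp_neg_mul_rpow (p := 1) (s := a - 1) (by linarith) one_pos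
    hr).congr_fun (fun t _ => ?_) measurableSet_Ioi
  simp

lemma integral_rpow_mul_exp_neg_norm_sq {E : Type*} [NormedAddCommGroup E] {s : ℝ} (hs : 0 < s)
    {x : E} {a : ℝ} (ha : x = 0 → a = 0) (w : ℝ) :
    ∫ t in Set.Ioi (0 : ℝ), t ^ (s - 1) * (a * Real.exp (-(Real.pi * t) * ‖x‖ ^ 2) * w) =
      Real.Gamma s / Real.pi ^ s * (a / ‖x‖ ^ (2 * s) * w) := by
  rcases eq_or_ne x 0 with hx | hx
  · simp [ha hx]
  have hx' : 0 < ‖x‖ := norm_pos_iff.2 hx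
  have hπ := Real.pi_pos
  have h := Real.integral_rpow_mul_exp_neg_mul_Ioi hs (r := Real.pi * ‖x‖ ^ 2) (by positivity)
  have e : ∀ t : ℝ, t ^ (s - 1) * (a * Real.exp (-(Real.pi * t) * ‖x‖ ^ 2) * w) =
      a * w * (t ^ (s - 1) * Real.exp (-(Real.pi * ‖x‖ ^ 2 * t))) := fun t => by
    rw [show -(Real.pi * t) * ‖x‖ ^ 2 = -(Real.pi * ‖x‖ ^ 2 * t) by ring]; ring
  simp_rw [e]
  rw [integral_const_mul, h, one_div, Real.inv_rpow (by positivity),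
    Real.mul_rpow hπ.le (by positivity), ← Real.rpow_natCast, ← Real.rpow_mul hx'.le]
  push_cast
  field_simp

lemma integrable_rpow_mul_coord_mul_exp_mul_sin (d : ℕ) (hd : 0 < d) (α : ℝ) (hα1 : 1 < α)
    (hα2 : α < 2) (j : Fin d) (ξ : EuclideanSpace ℝ (Fin d)) :
    Integrable (fun p : EuclideanSpace ℝ (Fin d) × ℝ => p.2 ^ (((d : ℝ) + α) / 2 - 1) *
        (p.1 j * Real.exp (-(Real.pi * p.2) * ‖p.1‖ ^ 2) *
          Real.sin (2 * Real.pi * inner ℝ ξ p.1)))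
      (volume.prod (volume.restrict (Set.Ioi 0))) := by
  have hs : 0 < ((d : ℝ) + α) / 2 := by positivity
  have hcoord : ∀ x : EuclideanSpace ℝ (Fin d), x = 0 → x j = 0 := by rintro _ rfl; rfl
  rw [integrable_prod_iff (by
    refine Measurable.aestronglyMeasurable ?_
    fun_prop)]
  refine ⟨.of_forall fun x => ?_, ?_⟩
  · rcases eq_or_ne x 0 with rfl | hx
    · simp
    have hx' : 0 < ‖x‖ := norm_pos_iff.2 hx
    refine ((integrableOn_rpow_mul_exp_neg_mul hs (r := Real.pi * ‖x‖ ^ 2)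
      (by have := Real.pi_pos; positivity)).const_mul
        (x j * Real.sin (2 * Real.pi * inner ℝ ξ x))).congr (.of_forall fun t => ?_)
    simp only
    rw [show -(Real.pi * t) * ‖x‖ ^ 2 = -(Real.pi * ‖x‖ ^ 2 * t) by ring]
    ring
  · have hK : Integrable (fun x => (oddKernel d α j x : ℂ) *
        (Real.sin (2 * Real.pi * inner ℝ ξ x) : ℂ)) := by
      refine integrable_oddKernel_mul d hd α hα1 hα2 j (by fun_prop)
        (C := 1 + 2 * Real.pi * ‖ξ‖) fun x => ?_
      rw [Complex.norm_real]
      exact abs_sin_inner_le ξ x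
    refine (hK.norm.const_mul (Real.Gamma (((d : ℝ) + α) / 2) /
      Real.pi ^ (((d : ℝ) + α) / 2))).congr (.of_forall fun x => ?_)
    have := integral_rpow_mul_exp_neg_norm_sq hs (x := x) (a := |x j|)
      (fun hx => by simp [hcoord x hx]) |Real.sin (2 * Real.pi * inner ℝ ξ x)|
    rw [mul_div_cancel₀ _ two_ne_zero] at this
    simp only
    rw [norm_mul, Complex.norm_real, Complex.norm_real, oddKernel, norm_div,
      Real.norm_of_nonneg (r := ‖x‖ ^ ((d : ℝ) + α)) (by positivity), Real.norm_eq_abs,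
      Real.norm_eq_abs, ← this]
    refine setIntegral_congr_fun measurableSet_Ioi fun t (ht : 0 < t) => ?_
    simp [abs_of_nonneg (Real.rpow_nonneg ht.le _)]

/-- The constant `C` such that the sine transform of `x_j |x|^{-d-α}` is `C ξ_j |ξ|^{α-2}`. -/
noncomputable def sineTransformConst (d : ℕ) (α : ℝ) : ℝ :=
  Real.pi ^ (((d : ℝ) + α) / 2) / Real.Gamma (((d : ℝ) + α) / 2) *
    (Real.Gamma (1 - α / 2) / Real.pi ^ (1 - α / 2))

lemma sineTransformConst_pos (d : ℕ) {α : ℝ} (hα1 : 1 < α) (hα2 : α < 2) :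
    0 < sineTransformConst d α := by
  have hπ := Real.pi_pos
  have h1 := Real.Gamma_pos_of_pos (s := ((d : ℝ) + α) / 2) (by positivity)
  have h2 := Real.Gamma_pos_of_pos (s := 1 - α / 2) (by linarith)
  unfold sineTransformConst
  positivity

lemma integral_oddKernel_mul_sin (d : ℕ) (hd : 0 < d) (α : ℝ) (hα1 : 1 < α) (hα2 : α < 2)
    (j : Fin d) (ξ : EuclideanSpace ℝ (Fin d)) :
    ∫ x, oddKernel d α j x * Real.sin (2 * Real.pi * inner ℝ ξ x) =
      sineTransformConst d α * (ξ j * ‖ξ‖ ^ (α - 2)) := by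
  rcases eq_or_ne ξ 0 with rfl | hξ
  · simp
  have hξ' : 0 < ‖ξ‖ := norm_pos_iff.2 hξ
  have hπ := Real.pi_pos
  have hs : 0 < ((d : ℝ) + α) / 2 := by positivity
  have hΓ := Real.Gamma_pos_of_pos hs
  have hswap := integral_integral_swap (f := fun (x : EuclideanSpace ℝ (Fin d)) (t : ℝ) =>
      t ^ (((d : ℝ) + α) / 2 - 1) * (x j * Real.exp (-(Real.pi * t) * ‖x‖ ^ 2) *
        Real.sin (2 * Real.pi * inner ℝ ξ x)))
    (integrable_rpow_mul_coord_mul_exp_mul_sin d hd α hα1 hα2 j ξ)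
  have hl : ∀ x : EuclideanSpace ℝ (Fin d), ∫ t in Set.Ioi (0 : ℝ), t ^ (((d : ℝ) + α) / 2 - 1) *
      (x j * Real.exp (-(Real.pi * t) * ‖x‖ ^ 2) * Real.sin (2 * Real.pi * inner ℝ ξ x)) =
      Real.Gamma (((d : ℝ) + α) / 2) / Real.pi ^ (((d : ℝ) + α) / 2) *
        (oddKernel d α j x * Real.sin (2 * Real.pi * inner ℝ ξ x)) := fun x => by
    rw [integral_rpow_mul_exp_neg_norm_sq hs (by rintro rfl; rfl), oddKernel,
      mul_div_cancel₀ _ two_ne_zero]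
  have hr : ∫ t in Set.Ioi (0 : ℝ), ∫ x : EuclideanSpace ℝ (Fin d),
      t ^ (((d : ℝ) + α) / 2 - 1) *
      (x j * Real.exp (-(Real.pi * t) * ‖x‖ ^ 2) * Real.sin (2 * Real.pi * inner ℝ ξ x)) =
      ξ j * ((1 / (Real.pi * ‖ξ‖ ^ 2)) ^ (1 - α / 2) * Real.Gamma (1 - α / 2)) := by
    rw [← integral_rpow_mul_exp_neg_div (by linarith) (by positivity), ← integral_const_mul]
    refine setIntegral_congr_fun measurableSet_Ioi fun t (ht : 0 < t) => ?_
    simp only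
    rw [integral_const_mul, integral_coord_mul_exp_mul_sin_inner d ht, mul_left_comm, ← mul_assoc
      (t ^ _), ← Real.rpow_add ht]
    congr 3
    ring
  simp only [hl] at hswap
  rw [hr, integral_const_mul] at hswap
  have hpow : (1 / (Real.pi * ‖ξ‖ ^ 2)) ^ (1 - α / 2) =
      (Real.pi ^ (1 - α / 2))⁻¹ * ‖ξ‖ ^ (α - 2) := by
    rw [one_div, Real.inv_rpow (by positivity), Real.mul_rpow hπ.le (by positivity), mul_inv,
      ← Real.rpow_natCast, ← Real.rpow_mul hξ'.le, ← Real.rpow_neg hξ'.le]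
    congr 2; push_cast; ring
  rw [hpow] at hswap
  have hc : Real.Gamma (((d : ℝ) + α) / 2) / Real.pi ^ (((d : ℝ) + α) / 2) ≠ 0 := by positivity
  apply mul_left_cancel₀ hc
  rw [hswap, sineTransformConst]
  field_simp

lemma fourier_sub_fourier_neg (d : ℕ) (φ : SchwartzMap (EuclideanSpace ℝ (Fin d)) ℂ)
    (x : EuclideanSpace ℝ (Fin d)) :
    SchwartzMap.fourierTransformCLM ℂ φ x - SchwartzMap.fourierTransformCLM ℂ φ (-x) =
      -2 * Complex.I * ∫ ξ, (Real.sin (2 * Real.pi * inner ℝ ξ x) : ℂ) * φ ξ := by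
  have hi : ∀ y : EuclideanSpace ℝ (Fin d),
      Integrable (fun ξ => Real.fourierChar (-inner ℝ ξ y) • φ ξ) :=
    fun y => (Real.fourierIntegral_convergent_iff y).2 φ.integrable
  simp only [SchwartzMap.fourierTransformCLM_apply, SchwartzMap.fourier_coe, Real.fourier_eq]
  rw [← integral_sub (hi x) (hi (-x)), ← integral_const_mul]
  congr 1 with ξ
  simp only [Circle.smul_def, Real.fourierChar_apply, inner_neg_right, neg_neg, smul_eq_mul,
    Complex.ofReal_sin]
  rw [Complex.sin]
  have e1 : ((2 * Real.pi * -inner ℝ ξ x : ℝ) : ℂ) * Complex.I =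
      -((2 * Real.pi * inner ℝ ξ x : ℝ) : ℂ) * Complex.I := by push_cast; ring
  rw [e1]
  linear_combination ((Complex.exp (-((2 * Real.pi * inner ℝ ξ x : ℝ) : ℂ) * Complex.I) -
    Complex.exp (((2 * Real.pi * inner ℝ ξ x : ℝ) : ℂ) * Complex.I)) * φ ξ) * Complex.I_sq

lemma integrable_oddKernel_mul_sin_mul (d : ℕ) (hd : 0 < d) (α : ℝ) (hα1 : 1 < α) (hα2 : α < 2)
    (j : Fin d) (φ : SchwartzMap (EuclideanSpace ℝ (Fin d)) ℂ) :
    Integrable (fun p : EuclideanSpace ℝ (Fin d) × EuclideanSpace ℝ (Fin d) =>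
      (oddKernel d α j p.1 : ℂ) * ((Real.sin (2 * Real.pi * inner ℝ p.2 p.1) : ℂ) * φ p.2))
      (volume.prod volume) := by
  have hφ : Integrable (fun ξ => (1 + 2 * Real.pi * ‖ξ‖) * ‖φ ξ‖) := by
    refine (φ.integrable.norm.add
      ((φ.integrable_pow_mul volume 1).const_mul (2 * Real.pi))).congr (.of_forall fun ξ => ?_)
    simp only [Pi.add_apply, pow_one]
    ring
  refine ((integrable_norm_rpow_mul_min d hd α hα1 hα2).mul_prod hφ).mono' ?_
    (.of_forall fun p => ?_)
  · have := measurable_oddKernel d α j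
    have := φ.continuous
    refine Measurable.aestronglyMeasurable ?_
    fun_prop
  · refine (norm_oddKernel_mul_le d α j (C := (1 + 2 * Real.pi * ‖p.2‖) * ‖φ p.2‖) ?_).trans_eq
      (mul_comm _ _)
    rw [norm_mul, Complex.norm_real, mul_right_comm (1 + 2 * Real.pi * ‖p.2‖)]
    exact mul_le_mul_of_nonneg_right (abs_sin_inner_le p.2 p.1) (norm_nonneg _)

lemma pvOddKernel_fourier (d : ℕ) (hd : 0 < d) (α : ℝ) (hα1 : 1 < α) (hα2 : α < 2)
    (j : Fin d) (φ : SchwartzMap (EuclideanSpace ℝ (Fin d)) ℂ) :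
    pvOddKernel d hd α hα1 hα2 j (SchwartzMap.fourierTransformCLM ℂ φ) =
      ∫ ξ, (Complex.I * ((-sineTransformConst d α : ℝ) : ℂ) * ((ξ j : ℝ) : ℂ) *
        ((‖ξ‖ ^ (α - 2) : ℝ) : ℂ)) * φ ξ := by
  have hswap := integral_integral_swap (f := fun x ξ : EuclideanSpace ℝ (Fin d) =>
      (oddKernel d α j x : ℂ) * ((Real.sin (2 * Real.pi * inner ℝ ξ x) : ℂ) * φ ξ))
    (integrable_oddKernel_mul_sin_mul d hd α hα1 hα2 j φ)
  rw [pvOddKernel_apply]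
  simp only [fourier_sub_fourier_neg]
  calc 2⁻¹ * ∫ x, (oddKernel d α j x : ℂ) *
        (-2 * Complex.I * ∫ ξ, (Real.sin (2 * Real.pi * inner ℝ ξ x) : ℂ) * φ ξ)
      = -Complex.I * ∫ x, ∫ ξ, (oddKernel d α j x : ℂ) *
          ((Real.sin (2 * Real.pi * inner ℝ ξ x) : ℂ) * φ ξ) := by
        rw [← integral_const_mul, ← integral_const_mul]
        congr 1 with x
        rw [integral_const_mul]
        ring
    _ = _ := by
        rw [hswap, ← integral_const_mul]
        congr 1 with ξ
        have h : ∫ x, (oddKernel d α j x : ℂ) *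
            ((Real.sin (2 * Real.pi * inner ℝ ξ x) : ℂ) * φ ξ) =
            ((∫ x, oddKernel d α j x * Real.sin (2 * Real.pi * inner ℝ ξ x) : ℝ) : ℂ) * φ ξ := by
          rw [← integral_complex_ofReal, ← integral_mul_const]
          congr 1 with x
          push_cast
          ring
        rw [h, integral_oddKernel_mul_sin d hd α hα1 hα2]
        push_cast
        ring

/-- For `1 < α < 2` and `j ∈ {1,…,d}`, the principal value of the kernel
`x_j |x|^{−d−α}` defines a tempered distribution `u`, and there is a nonzero real constant
`c(d,α)` such that the Fourier transform of `u` is the locally integrable function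
`ξ ↦ i c(d,α) ξ_j |ξ|^{α−2}`. -/
theorem fourier_of_pv_odd_kernel (d : ℕ) (hd : 0 < d) (α : ℝ) (hα1 : 1 < α) (hα2 : α < 2)
    (j : Fin d) :
    ∃ u : SchwartzMap (EuclideanSpace ℝ (Fin d)) ℂ →L[ℂ] ℂ,
      (∀ φ : SchwartzMap (EuclideanSpace ℝ (Fin d)) ℂ,
        Tendsto (fun ε : ℝ =>
            ∫ x in {x : EuclideanSpace ℝ (Fin d) | ε < ‖x‖},
              (((x j : ℝ) : ℂ) / ((‖x‖ ^ ((d : ℝ) + α) : ℝ) : ℂ)) * φ x)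
          (nhdsWithin 0 (Set.Ioi 0)) (nhds (u φ))) ∧
      ∃ c : ℝ, c ≠ 0 ∧
        ∀ φ : SchwartzMap (EuclideanSpace ℝ (Fin d)) ℂ,
          u (SchwartzMap.fourierTransformCLM ℂ φ) =
            ∫ ξ : EuclideanSpace ℝ (Fin d),
              (Complex.I * (c : ℂ) * ((ξ j : ℝ) : ℂ) * ((‖ξ‖ ^ (α - 2) : ℝ) : ℂ)) * φ ξ := by
  refine ⟨pvOddKernel d hd α hα1 hα2 j, fun φ => ?_, -sineTransformConst d α,
    neg_ne_zero.2 (sineTransformConst_pos d hα1 hα2).ne', pvOddKernel_fourier d hd α hα1 hα2 j⟩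
  simpa only [oddKernel, Complex.ofReal_div] using
    tendsto_setIntegral_oddKernel_mul d hd α hα1 hα2 j φ
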